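/- Let θ : ℝ → ℝ be continuous and ε ∈ ℝ, let a < b be reals, and suppose ε + θ(ξ) + 1 > 0 and ε − θ(ξ) − 1 > 0 for all ξ ∈ [a, b]. Let ψ₁, ψ₂ : ℝ → ℝ be a not-identically-zero differentiable solution of ψ₁' = (1+θ+ε)ψ₂, ψ₂' = (1+θ−ε)ψ₁ with ψ₁(a) = ψ₁(b) = 0 and ψ₁(ξ) ≠ 0 for all ξ ∈ (a, b). Then there exists exactly one c ∈ (a, b) with ψ₂(c) = 0. -/

import Mathlib

/-- Node-interlacing property (start of Appendix B): in the allowed region, between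
two consecutive nodes of `ψ₁` there is exactly one node of `ψ₂`. -/
theorem dirac_node_interlacing
    (θ : ℝ → ℝ) (hθ : Continuous θ) (ε : ℝ) (a b : ℝ) (hab : a < b)
    (hallowed : ∀ ξ ∈ Set.Icc a b, ε + θ ξ + 1 > 0 ∧ ε - θ ξ - 1 > 0)
    (ψ₁ ψ₂ : ℝ → ℝ)
    (hd1 : Differentiable ℝ ψ₁) (hd2 : Differentiable ℝ ψ₂)
    (heq1 : ∀ ξ, deriv ψ₁ ξ = (1 + θ ξ + ε) * ψ₂ ξ)
    (heq2 : ∀ ξ, deriv ψ₂ ξ = (1 + θ ξ - ε) * ψ₁ ξ)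
    (hnontriv : ∃ ξ, ψ₁ ξ ≠ 0 ∨ ψ₂ ξ ≠ 0)
    (ha : ψ₁ a = 0) (hb : ψ₁ b = 0)
    (hnode : ∀ ξ ∈ Set.Ioo a b, ψ₁ ξ ≠ 0) :
    ∃! c, c ∈ Set.Ioo a b ∧ ψ₂ c = 0 := by
  have no_two_nodes : ∀ x ∈ Set.Ioo a b, ∀ y ∈ Set.Ioo a b,
      ψ₂ x = 0 → ψ₂ y = 0 → ¬ x < y := by
    intro x hx y hy hx0 hy0 hxy
    obtain ⟨d, hd, hd0⟩ :=
      exists_deriv_eq_zero hxy hd2.continuous.continuousOn (hx0.trans hy0.symm)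
    have hdab : d ∈ Set.Ioo a b := ⟨hx.1.trans hd.1, hd.2.trans hy.2⟩
    have hpos := (hallowed d (Set.Ioo_subset_Icc_self hdab)).2
    rw [heq2] at hd0
    rcases mul_eq_zero.mp hd0 with h | h
    · linarith
    · exact hnode d hdab h
  obtain ⟨c, hc, hc0⟩ :=
    exists_deriv_eq_zero hab hd1.continuous.continuousOn (ha.trans hb.symm)
  have hpos := (hallowed c (Set.Ioo_subset_Icc_self hc)).1
  rw [heq1] at hc0
  have hψc : ψ₂ c = 0 := (mul_eq_zero.mp hc0).resolve_left (by linarith)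
  refine ⟨c, ⟨hc, hψc⟩, fun y hy => ?_⟩
  exact le_antisymm (not_lt.mp (no_two_nodes c hc y hy.1 hψc hy.2))
    (not_lt.mp (no_two_nodes y hy.1 c hc hy.2 hψc))
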